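/- With 𝒜 as defined, 𝒜·𝒜ᵀ = (ρ_{r_0}ρ_{r_0}ᵀ ⊗ ⋯ ⊗ ρ_{r_{Q1−1}}ρ_{r_{Q1−1}}ᵀ) ⊗ 𝒟 ⊗ I_{n_x}^{⊗(j−1)}; consequently 𝒜·𝒜ᵀ is a diagonal matrix all of whose diagonal entries lie in {0,1}, and in particular 𝒜·𝒜ᵀ is symmetric and idempotent ((𝒜𝒜ᵀ)² = 𝒜𝒜ᵀ). -/

import Mathlib

noncomputable section
open Matrix BigOperators Finset

/-- Kronecker product of complex matrices, with the big-endian index identification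
`i = p·i₁ + i₂` (first factor is the high-order register). -/
def kron {m n p q : ℕ} (A : Matrix (Fin m) (Fin n) ℂ) (B : Matrix (Fin p) (Fin q) ℂ) :
    Matrix (Fin (m * p)) (Fin (n * q)) ℂ :=
  Matrix.of fun i j => A i.divNat j.divNat * B i.modNat j.modNat

/-- `l`-fold Kronecker power `B^{⊗l}`. -/
def kronPow {n : ℕ} (B : Matrix (Fin n) (Fin n) ℂ) : (l : ℕ) → Matrix (Fin (n ^ l)) (Fin (n ^ l)) ℂ
  | 0 => 1
  | l + 1 => kron (kronPow B l) B

/-- Recast a matrix along equalities of its dimensions. -/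
def mcast {a b c d : ℕ} (h1 : a = b) (h2 : c = d) (M : Matrix (Fin a) (Fin c) ℂ) :
    Matrix (Fin b) (Fin d) ℂ :=
  M.submatrix (Fin.cast h1.symm) (Fin.cast h2.symm)

/-- The commutation matrix `K^{(a,b)}`, the `ab × ab` permutation matrix determined by
`K (x ⊗ y) = y ⊗ x`: column `b·x + y` has its unique `1` in row `a·y + x`. -/
def commMat (a b : ℕ) : Matrix (Fin (a * b)) (Fin (a * b)) ℂ :=
  Matrix.of fun i j => if (i : ℕ) = a * ((j : ℕ) % b) + (j : ℕ) / b then 1 else 0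

/-- τ0, τ1, τ2, τ3. -/
def τ : Fin 4 → Matrix (Fin 2) (Fin 2) ℂ
  | 0 => !![1, 0; 0, 0]
  | 1 => !![0, 1; 0, 0]
  | 2 => !![0, 0; 1, 0]
  | 3 => !![0, 0; 0, 1]

/-- ρ0 = τ0, ρ1 = τ1, ρ2 = τ2, ρ3 = τ3, ρ4 = I₂. -/
def ρ : Fin 5 → Matrix (Fin 2) (Fin 2) ℂ
  | 0 => !![1, 0; 0, 0]
  | 1 => !![0, 1; 0, 0]
  | 2 => !![0, 0; 1, 0]
  | 3 => !![0, 0; 0, 1]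
  | 4 => 1

def σx : Matrix (Fin 2) (Fin 2) ℂ := !![0, 1; 1, 0]

/-- ρ̄ = σx for ρ1, ρ2 and ρ̄ = I₂ for ρ0, ρ3, ρ4. -/
def ρbar : Fin 5 → Matrix (Fin 2) (Fin 2) ℂ
  | 0 => 1
  | 1 => σx
  | 2 => σx
  | 3 => 1
  | 4 => 1

/-- The Kronecker product `f 0 ⊗ f 1 ⊗ ⋯ ⊗ f (Q−1)` of 2×2 matrices (leftmost factor
is the most significant register). -/
def kronSeq : (Q : ℕ) → (Fin Q → Matrix (Fin 2) (Fin 2) ℂ) → Matrix (Fin (2 ^ Q)) (Fin (2 ^ Q)) ℂ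
  | 0, _ => 1
  | Q + 1, f => kron (kronSeq Q fun k => f k.castSucc) (f (Fin.last Q))

/-- A (real) permutation matrix: a 0/1 matrix with exactly one 1 in each row and column. -/
def IsPermMatrix {N : ℕ} (M : Matrix (Fin N) (Fin N) ℂ) : Prop :=
  (∀ i j, M i j = 0 ∨ M i j = 1) ∧ (∀ i, ∃! j, M i j = 1) ∧ (∀ j, ∃! i, M i j = 1)

/-- 𝒟 = τ0^{⊗s} ⊗ I_{n_x}, where n_x = 2^s. -/
def Dmat (s : ℕ) : Matrix (Fin ((2 ^ s) ^ 2)) (Fin ((2 ^ s) ^ 2)) ℂ :=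
  mcast (by ring) (by ring) (kron (kronPow (τ 0) s) (1 : Matrix (Fin (2 ^ s)) (Fin (2 ^ s)) ℂ))

/-- The middle factor (τ0^{⊗s} ⊗ K^{(n_x^l,n_x)}) · (𝒟P ⊗ I_{n_x}^{⊗l}) · K^{(n_x²,n_x^l)}
of 𝒜. -/
def midA (s l : ℕ) (P : Matrix (Fin ((2 ^ s) ^ 2)) (Fin ((2 ^ s) ^ 2)) ℂ) :
    Matrix (Fin ((2 ^ s) ^ (l + 2))) (Fin ((2 ^ s) ^ (l + 2))) ℂ :=
  mcast (by ring) (by ring) (kron (kronPow (τ 0) s) (commMat ((2 ^ s) ^ l) (2 ^ s))) *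
    mcast (by ring) (by ring)
      (kron (Dmat s * P) (1 : Matrix (Fin ((2 ^ s) ^ l)) (Fin ((2 ^ s) ^ l)) ℂ)) *
    mcast (by ring) (by ring) (commMat ((2 ^ s) ^ 2) ((2 ^ s) ^ l))

/-- The middle factor (I_{n_x} ⊗ K^{(n_x^l,n_x)}) · (P ⊗ I_{n_x}^{⊗l}) · K^{(n_x²,n_x^l)}
of Ā. -/
def midAbar (s l : ℕ) (P : Matrix (Fin ((2 ^ s) ^ 2)) (Fin ((2 ^ s) ^ 2)) ℂ) :
    Matrix (Fin ((2 ^ s) ^ (l + 2))) (Fin ((2 ^ s) ^ (l + 2))) ℂ :=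
  mcast (by ring) (by ring)
      (kron (1 : Matrix (Fin (2 ^ s)) (Fin (2 ^ s)) ℂ) (commMat ((2 ^ s) ^ l) (2 ^ s))) *
    mcast (by ring) (by ring) (kron P (1 : Matrix (Fin ((2 ^ s) ^ l)) (Fin ((2 ^ s) ^ l)) ℂ)) *
    mcast (by ring) (by ring) (commMat ((2 ^ s) ^ 2) ((2 ^ s) ^ l))

/-- 𝒜 = (ρ_{r_0} ⊗ ⋯ ⊗ ρ_{r_{Q1−1}}) ⊗
  [(τ0^{⊗s} ⊗ K^{(n_x^l,n_x)}) · (𝒟P ⊗ I_{n_x}^{⊗l}) · K^{(n_x²,n_x^l)}] ⊗ I_{n_x}^{⊗(j−l−1)}. -/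
def Afull (s Q1 l j : ℕ) (r : Fin Q1 → Fin 5)
    (P : Matrix (Fin ((2 ^ s) ^ 2)) (Fin ((2 ^ s) ^ 2)) ℂ) :
    Matrix (Fin (2 ^ Q1 * ((2 ^ s) ^ (l + 2) * (2 ^ s) ^ (j - l - 1))))
      (Fin (2 ^ Q1 * ((2 ^ s) ^ (l + 2) * (2 ^ s) ^ (j - l - 1)))) ℂ :=
  kron (kronSeq Q1 fun k => ρ (r k))
    (kron (midA s l P) (kronPow (1 : Matrix (Fin (2 ^ s)) (Fin (2 ^ s)) ℂ) (j - l - 1)))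

/-- Ā = (ρ̄_{r_0} ⊗ ⋯ ⊗ ρ̄_{r_{Q1−1}}) ⊗
  [(I_{n_x} ⊗ K^{(n_x^l,n_x)}) · (P ⊗ I_{n_x}^{⊗l}) · K^{(n_x²,n_x^l)}] ⊗ I_{n_x}^{⊗(j−l−1)}. -/
def Abarfull (s Q1 l j : ℕ) (r : Fin Q1 → Fin 5)
    (P : Matrix (Fin ((2 ^ s) ^ 2)) (Fin ((2 ^ s) ^ 2)) ℂ) :
    Matrix (Fin (2 ^ Q1 * ((2 ^ s) ^ (l + 2) * (2 ^ s) ^ (j - l - 1))))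
      (Fin (2 ^ Q1 * ((2 ^ s) ^ (l + 2) * (2 ^ s) ^ (j - l - 1)))) ℂ :=
  kron (kronSeq Q1 fun k => ρbar (r k))
    (kron (midAbar s l P) (kronPow (1 : Matrix (Fin (2 ^ s)) (Fin (2 ^ s)) ℂ) (j - l - 1)))

open scoped Kronecker

/-! ### Algebra of `kron` and `mcast` -/

theorem kron_eq_submatrix {m n p q : ℕ} (A : Matrix (Fin m) (Fin n) ℂ)
    (B : Matrix (Fin p) (Fin q) ℂ) :
    kron A B = (A ⊗ₖ B).submatrix finProdFinEquiv.symm finProdFinEquiv.symm := rfl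

theorem kron_mul_kron {m n o p q t : ℕ} (A : Matrix (Fin m) (Fin n) ℂ)
    (B : Matrix (Fin p) (Fin q) ℂ) (C : Matrix (Fin n) (Fin o) ℂ) (D : Matrix (Fin q) (Fin t) ℂ) :
    kron A B * kron C D = kron (A * C) (B * D) := by
  simp only [kron_eq_submatrix, Matrix.submatrix_mul_equiv, Matrix.mul_kronecker_mul]

theorem transpose_kron {m n p q : ℕ} (A : Matrix (Fin m) (Fin n) ℂ)
    (B : Matrix (Fin p) (Fin q) ℂ) : (kron A B)ᵀ = kron Aᵀ Bᵀ := rfl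

theorem kron_diagonal {m p : ℕ} (d : Fin m → ℂ) (e : Fin p → ℂ) :
    kron (diagonal d) (diagonal e) = diagonal fun i => d i.divNat * e i.modNat := by
  rw [kron_eq_submatrix, Matrix.diagonal_kronecker_diagonal, Matrix.submatrix_diagonal_equiv]
  rfl

theorem kron_one_one {m p : ℕ} :
    kron (1 : Matrix (Fin m) (Fin m) ℂ) (1 : Matrix (Fin p) (Fin p) ℂ) = 1 := by
  rw [kron_eq_submatrix, Matrix.one_kronecker_one, Matrix.submatrix_one_equiv]

theorem mcast_mul_mcast {a b c d e f : ℕ} (h₁ : a = b) (h₂ : c = d) (h₃ : c = d) (h₄ : e = f)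
    (M : Matrix (Fin a) (Fin c) ℂ) (N : Matrix (Fin c) (Fin e) ℂ) :
    mcast h₁ h₂ M * mcast h₃ h₄ N = mcast h₁ h₄ (M * N) := by
  subst h₁ h₂ h₄; rfl

theorem transpose_mcast {a b c d : ℕ} (h₁ : a = b) (h₂ : c = d) (M : Matrix (Fin a) (Fin c) ℂ) :
    (mcast h₁ h₂ M)ᵀ = mcast h₂ h₁ Mᵀ := rfl

theorem mcast_mcast {a b c d e f : ℕ} (h₁ : a = b) (h₂ : c = d) (h₃ : b = e) (h₄ : d = f)
    (M : Matrix (Fin a) (Fin c) ℂ) :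
    mcast h₃ h₄ (mcast h₁ h₂ M) = mcast (h₁.trans h₃) (h₂.trans h₄) M := rfl

theorem mcast_one {a b : ℕ} (h₁ h₂ : a = b) : mcast h₁ h₂ 1 = 1 := by
  subst h₁; rfl

theorem mcast_rfl {a b : ℕ} (M : Matrix (Fin a) (Fin b) ℂ) : mcast rfl rfl M = M := rfl

theorem kron_mcast_left {a b c d p q : ℕ} (h₁ : a = b) (h₂ : c = d)
    (A : Matrix (Fin a) (Fin c) ℂ) (B : Matrix (Fin p) (Fin q) ℂ) :
    kron (mcast h₁ h₂ A) B = mcast (by rw [h₁]) (by rw [h₂]) (kron A B) := by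
  subst h₁ h₂; rfl

theorem kron_mcast_right {a b c d p q : ℕ} (h₁ : a = b) (h₂ : c = d)
    (A : Matrix (Fin p) (Fin q) ℂ) (B : Matrix (Fin a) (Fin c) ℂ) :
    kron A (mcast h₁ h₂ B) = mcast (by rw [h₁]) (by rw [h₂]) (kron A B) := by
  subst h₁ h₂; rfl

theorem kron_assoc {m n p q t u : ℕ} (A : Matrix (Fin m) (Fin n) ℂ)
    (B : Matrix (Fin p) (Fin q) ℂ) (C : Matrix (Fin t) (Fin u) ℂ) :
    kron (kron A B) C = mcast (mul_assoc m p t).symm (mul_assoc n q u).symm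
      (kron A (kron B C)) := by
  ext i j
  have hd : ∀ {x y z : ℕ} (k : Fin (x * y * z)),
      k.divNat.divNat = (Fin.cast (mul_assoc x y z) k).divNat := fun k =>
    Fin.ext <| by simp [Nat.div_div_eq_div_mul, mul_comm]
  have hdm : ∀ {x y z : ℕ} (k : Fin (x * y * z)),
      k.divNat.modNat = (Fin.cast (mul_assoc x y z) k).modNat.divNat := fun k =>
    Fin.ext <| by simpa using (Nat.mod_mul_left_div_self _ _ _).symm
  have hm : ∀ {x y z : ℕ} (k : Fin (x * y * z)),
      k.modNat = (Fin.cast (mul_assoc x y z) k).modNat.modNat := fun k =>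
    Fin.ext <| by simp
  simp only [kron, mcast, Matrix.of_apply, Matrix.submatrix_apply, hd, hdm, ← hm, mul_assoc]

theorem kronPow_one {n : ℕ} (l : ℕ) : kronPow (1 : Matrix (Fin n) (Fin n) ℂ) l = 1 := by
  induction l with
  | zero => rfl
  | succ l ih => rw [kronPow, ih, kron_one_one]; rfl

theorem kronSeq_mul_kronSeq (Q : ℕ) (f g : Fin Q → Matrix (Fin 2) (Fin 2) ℂ) :
    kronSeq Q f * kronSeq Q g = kronSeq Q fun k => f k * g k := by
  induction Q with
  | zero => simp [kronSeq]
  | succ Q ih =>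
    simp only [kronSeq, ← ih]
    exact kron_mul_kron _ _ _ _

theorem transpose_kronSeq (Q : ℕ) (f : Fin Q → Matrix (Fin 2) (Fin 2) ℂ) :
    (kronSeq Q f)ᵀ = kronSeq Q fun k => (f k)ᵀ := by
  induction Q with
  | zero => simp [kronSeq]
  | succ Q ih =>
    simp only [kronSeq, ← ih]
    exact transpose_kron _ _

/-! ### Permutation matrices -/

theorem IsPermMatrix.mul_transpose {N : ℕ} {M : Matrix (Fin N) (Fin N) ℂ} (hM : IsPermMatrix M) :
    M * Mᵀ = 1 := by
  obtain ⟨h01, hrow, hcol⟩ := hM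
  ext i k
  obtain ⟨j, hj, hju⟩ := hrow i
  rw [Matrix.mul_apply, Finset.sum_eq_single j, Matrix.transpose_apply, hj, one_mul]
  · by_cases hik : i = k
    · rw [← hik, Matrix.one_apply_eq, hj]
    · rw [Matrix.one_apply_ne hik]
      exact (h01 k j).resolve_right fun h => hik ((hcol j).unique hj h)
  · intro b _ hb
    rw [(h01 i b).resolve_right fun h => hb (hju b h), zero_mul]
  · simp

theorem commMat_mul_transpose (a b : ℕ) : commMat a b * (commMat a b)ᵀ = 1 := by
  let e : Fin (a * b) ≃ Fin (a * b) := finProdFinEquiv.symm.trans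
    ((Equiv.prodComm _ _).trans (finProdFinEquiv.trans (finCongr (mul_comm b a))))
  have he : commMat a b = (1 : Matrix (Fin (a * b)) (Fin (a * b)) ℂ).submatrix id e := by
    ext i j
    simp only [commMat, Matrix.of_apply, Matrix.submatrix_apply, Matrix.one_apply, id, Fin.ext_iff]
    congr 2
    simp [e, Fin.divNat, Fin.modNat, add_comm]
  rw [he, Matrix.transpose_submatrix, Matrix.submatrix_mul_equiv]
  simp

/-! ### Diagonal matrices with entries in `{0, 1}` -/

/-- The matrix is diagonal with diagonal entries in `{0, 1}`. -/
def IsZeroOneDiag {N : ℕ} (M : Matrix (Fin N) (Fin N) ℂ) : Prop :=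
  ∃ d : Fin N → ℂ, (∀ i, d i = 0 ∨ d i = 1) ∧ M = diagonal d

namespace IsZeroOneDiag

theorem one {N : ℕ} : IsZeroOneDiag (1 : Matrix (Fin N) (Fin N) ℂ) :=
  ⟨fun _ => 1, fun _ => Or.inr rfl, rfl⟩

theorem kron {m p : ℕ} {A : Matrix (Fin m) (Fin m) ℂ} {B : Matrix (Fin p) (Fin p) ℂ}
    (hA : IsZeroOneDiag A) (hB : IsZeroOneDiag B) : IsZeroOneDiag (kron A B) := by
  obtain ⟨d, hd, rfl⟩ := hA
  obtain ⟨e, he, rfl⟩ := hB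
  refine ⟨_, fun i => ?_, kron_diagonal d e⟩
  rcases hd i.divNat with h | h <;> rcases he i.modNat with h' | h' <;> simp [h, h']

theorem of_mcast {a b : ℕ} {h₁ h₂ : a = b} {M : Matrix (Fin a) (Fin a) ℂ}
    (h : IsZeroOneDiag (mcast h₁ h₂ M)) : IsZeroOneDiag M := by
  subst h₁; exact h

theorem mcast {a b : ℕ} {M : Matrix (Fin a) (Fin a) ℂ} (h : IsZeroOneDiag M) (h₁ h₂ : a = b) :
    IsZeroOneDiag (mcast h₁ h₂ M) := by
  subst h₁; exact h

theorem kronPow {n : ℕ} {A : Matrix (Fin n) (Fin n) ℂ} (hA : IsZeroOneDiag A) (l : ℕ) :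
    IsZeroOneDiag (kronPow A l) := by
  induction l with
  | zero => exact one
  | succ l ih => exact ih.kron hA

theorem kronSeq (Q : ℕ) {f : Fin Q → Matrix (Fin 2) (Fin 2) ℂ} (hf : ∀ k, IsZeroOneDiag (f k)) :
    IsZeroOneDiag (kronSeq Q f) := by
  induction Q with
  | zero => exact one
  | succ Q ih => exact (ih fun k => hf k.castSucc).kron (hf _)

variable {N : ℕ} {M : Matrix (Fin N) (Fin N) ℂ}

theorem isDiag (h : IsZeroOneDiag M) : M.IsDiag := by
  obtain ⟨d, -, rfl⟩ := h
  exact Matrix.isDiag_diagonal d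

theorem apply_self (h : IsZeroOneDiag M) (i : Fin N) : M i i = 0 ∨ M i i = 1 := by
  obtain ⟨d, hd, rfl⟩ := h
  simpa using hd i

theorem transpose_eq (h : IsZeroOneDiag M) : Mᵀ = M := by
  obtain ⟨d, -, rfl⟩ := h
  exact Matrix.diagonal_transpose d

theorem mul_self (h : IsZeroOneDiag M) : M * M = M := by
  obtain ⟨d, hd, rfl⟩ := h
  rw [Matrix.diagonal_mul_diagonal]
  congr 1
  ext i
  rcases hd i with h | h <;> simp [h]

end IsZeroOneDiag

theorem isZeroOneDiag_τ_zero : IsZeroOneDiag (τ 0) := by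
  refine ⟨![1, 0], fun i => ?_, ?_⟩
  · fin_cases i <;> simp
  · ext i j
    fin_cases i <;> fin_cases j <;> simp [τ]

theorem isZeroOneDiag_ρ_mul_transpose (r : Fin 5) : IsZeroOneDiag (ρ r * (ρ r)ᵀ) := by
  have key : ∀ a b : ℂ, (a = 0 ∨ a = 1) → (b = 0 ∨ b = 1) → IsZeroOneDiag !![a, 0; 0, b] := by
    intro a b ha hb
    refine ⟨![a, b], fun i => ?_, ?_⟩
    · fin_cases i <;> simpa
    · ext i j
      fin_cases i <;> fin_cases j <;> simp
  fin_cases r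
  · convert key 1 0 (by simp) (by simp) using 1
    ext i j; fin_cases i <;> fin_cases j <;> simp [ρ, Matrix.mul_apply]
  · convert key 1 0 (by simp) (by simp) using 1
    ext i j; fin_cases i <;> fin_cases j <;> simp [ρ, Matrix.mul_apply]
  · convert key 0 1 (by simp) (by simp) using 1
    ext i j; fin_cases i <;> fin_cases j <;> simp [ρ, Matrix.mul_apply]
  · convert key 0 1 (by simp) (by simp) using 1
    ext i j; fin_cases i <;> fin_cases j <;> simp [ρ, Matrix.mul_apply]
  · convert IsZeroOneDiag.one (N := 2) using 1
    simp [ρ]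

theorem isZeroOneDiag_Dmat (s : ℕ) : IsZeroOneDiag (Dmat s) :=
  ((isZeroOneDiag_τ_zero.kronPow s).kron .one).mcast _ _

/-! ### The Gram matrix of the middle factor -/

theorem midA_mul_transpose (s l : ℕ) {P : Matrix (Fin ((2 ^ s) ^ 2)) (Fin ((2 ^ s) ^ 2)) ℂ}
    (hP : IsPermMatrix P) :
    midA s l P * (midA s l P)ᵀ = mcast (by ring) (by ring)
      (kron (Dmat s) (1 : Matrix (Fin ((2 ^ s) ^ l)) (Fin ((2 ^ s) ^ l)) ℂ)) := by
  have hT := isZeroOneDiag_τ_zero.kronPow s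
  have hD := isZeroOneDiag_Dmat s
  have hDP : (Dmat s * P) * (Dmat s * P)ᵀ = Dmat s := by
    rw [Matrix.transpose_mul, Matrix.mul_assoc, ← Matrix.mul_assoc P, hP.mul_transpose,
      Matrix.one_mul, hD.transpose_eq, hD.mul_self]
  have hI : kron (1 : Matrix (Fin (2 ^ s)) (Fin (2 ^ s)) ℂ)
      (1 : Matrix (Fin ((2 ^ s) ^ l)) (Fin ((2 ^ s) ^ l)) ℂ) =
        mcast (mul_comm _ _) (mul_comm _ _) 1 := by
    rw [kron_one_one, mcast_one]
  have hD' : kron (Dmat s) (1 : Matrix (Fin ((2 ^ s) ^ l)) (Fin ((2 ^ s) ^ l)) ℂ) =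
      mcast (by ring) (by ring) (kron (kronPow (τ 0) s)
        (1 : Matrix (Fin ((2 ^ s) ^ l * 2 ^ s)) (Fin ((2 ^ s) ^ l * 2 ^ s)) ℂ)) := by
    rw [Dmat, kron_mcast_left, kron_assoc, hI, kron_mcast_right, mcast_mcast, mcast_mcast]
  have cancel : ∀ {n : ℕ} (A B C : Matrix (Fin n) (Fin n) ℂ), C * Cᵀ = 1 →
      (A * B * C) * (A * B * C)ᵀ = A * (B * Bᵀ) * Aᵀ := by
    intro n A B C hC
    rw [Matrix.transpose_mul, Matrix.mul_assoc, ← Matrix.mul_assoc C, hC, Matrix.one_mul,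
      Matrix.transpose_mul]
    simp only [Matrix.mul_assoc]
  rw [midA, cancel]
  · rw [transpose_mcast, transpose_mcast, mcast_mul_mcast, transpose_kron, kron_mul_kron, hDP,
      Matrix.transpose_one, Matrix.one_mul, hD', mcast_mcast, mcast_mul_mcast, mcast_mul_mcast,
      transpose_kron, kron_mul_kron, kron_mul_kron, hT.transpose_eq, hT.mul_self,
      hT.mul_self, Matrix.mul_one, commMat_mul_transpose]
  · rw [transpose_mcast, mcast_mul_mcast, commMat_mul_transpose, mcast_one]

/-- With 𝒜 as defined,
𝒜·𝒜ᵀ = (ρ_{r_0}ρ_{r_0}ᵀ ⊗ ⋯ ⊗ ρ_{r_{Q1−1}}ρ_{r_{Q1−1}}ᵀ) ⊗ 𝒟 ⊗ I_{n_x}^{⊗(j−1)};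
consequently 𝒜·𝒜ᵀ is diagonal with diagonal entries in {0,1}, symmetric, and idempotent. -/
theorem statement4 (s Q1 l j : ℕ) (hs : 1 ≤ s) (hjl : l + 1 ≤ j) (r : Fin Q1 → Fin 5)
    (P : Matrix (Fin ((2 ^ s) ^ 2)) (Fin ((2 ^ s) ^ 2)) ℂ) (hP : IsPermMatrix P) :
    let 𝒜 := Afull s Q1 l j r P
    let G := 𝒜 * 𝒜ᵀ
    mcast
        (by have h : l + 2 + (j - l - 1) = 2 + (j - 1) := by omega
            rw [← pow_add, ← pow_add, h])
        (by have h : l + 2 + (j - l - 1) = 2 + (j - 1) := by omega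
            rw [← pow_add, ← pow_add, h]) G =
      kron (kronSeq Q1 fun k => ρ (r k) * (ρ (r k))ᵀ)
        (kron (Dmat s) (kronPow (1 : Matrix (Fin (2 ^ s)) (Fin (2 ^ s)) ℂ) (j - 1))) ∧
    G.IsDiag ∧ (∀ i, G i i = 0 ∨ G i i = 1) ∧ Gᵀ = G ∧ G * G = G := by
  intro 𝒜 G
  have hN : 2 ^ Q1 * ((2 ^ s) ^ (l + 2) * (2 ^ s) ^ (j - l - 1)) =
      2 ^ Q1 * ((2 ^ s) ^ 2 * (2 ^ s) ^ (j - 1)) := by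
    rw [← pow_add, ← pow_add, show l + 2 + (j - l - 1) = 2 + (j - 1) by omega]
  have hmain : mcast hN hN G = kron (kronSeq Q1 fun k => ρ (r k) * (ρ (r k))ᵀ)
      (kron (Dmat s) (kronPow (1 : Matrix (Fin (2 ^ s)) (Fin (2 ^ s)) ℂ) (j - 1))) := by
    have hj : (2 ^ s) ^ l * (2 ^ s) ^ (j - l - 1) = (2 ^ s) ^ (j - 1) := by
      rw [← pow_add]
      congr 1
      omega
    have hI : kron (1 : Matrix (Fin ((2 ^ s) ^ l)) (Fin ((2 ^ s) ^ l)) ℂ)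
        (1 : Matrix (Fin ((2 ^ s) ^ (j - l - 1))) (Fin ((2 ^ s) ^ (j - l - 1))) ℂ) =
          mcast hj.symm hj.symm 1 := by
      rw [kron_one_one, mcast_one]
    simp only [G, 𝒜, Afull]
    rw [transpose_kron, transpose_kron, kron_mul_kron, kron_mul_kron, midA_mul_transpose s l hP,
      transpose_kronSeq, kronSeq_mul_kronSeq, kronPow_one, kronPow_one, Matrix.transpose_one,
      Matrix.one_mul, kron_mcast_left, kron_assoc, hI, mcast_mcast, kron_mcast_right,
      mcast_mcast, kron_mcast_right, kron_mcast_right, mcast_mcast, mcast_rfl]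
  have hG : IsZeroOneDiag G := .of_mcast (hmain ▸
    (IsZeroOneDiag.kronSeq Q1 fun k => isZeroOneDiag_ρ_mul_transpose (r k)).kron
      ((isZeroOneDiag_Dmat s).kron (IsZeroOneDiag.one.kronPow (j - 1))))
  exact ⟨hmain, hG.isDiag, hG.apply_self, hG.transpose_eq, hG.mul_self⟩
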